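/- Let φ : ℝ → ℝ be a C^∞ function with φ'(1) > 0 and φ''(1) = 0. Then there exist real numbers k₁, k₂, h₁, h₂ with the following two properties, valid for every open set Ω ⊆ ℝ² containing (0,0) and every function u₀ : Ω → ℝ of class C³ with Taylor expansion u₀(x,y) = (√2/2)x + (√2/2)y + k₁x² + k₂y² + h₁x³ + h₂y³ + o((x²+y²)^{3/2}) as (x,y) → (0,0): (1) there exist δ > 0, a > 0 and a convex function g : (−δ,δ) → (−a,a) such that {(x,y) ∈ (−δ,δ)×(−a,a) : |∇u₀(x,y)| > 1} = {(x,y) ∈ (−δ,δ)×(−a,a) : y > g(x)}; (2) for every T > 0 and every u ∈ C²(Ω×[0,T)) satisfying u_t = div(φ'(|∇u|)·∇u/|∇u|) at every point where ∇u ≠ 0, and u(x,y,0) = u₀(x,y) on Ω, there exists t₀ ∈ (0,T) such that |∇u(0,0,t)| > 1 for all t ∈ (0,t₀). In other words, the subcritical region does not expand: the origin, initially on the interface bounding a locally convex supercritical region, is absorbed by the supercritical region. -/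

import Mathlib

open Asymptotics Filter Topology

/-- squared norm of the gradient of `u₀ = u₀(x,y)` -/
noncomputable def gradSq0 (u₀ : ℝ → ℝ → ℝ) (x y : ℝ) : ℝ :=
  (deriv (fun s => u₀ s y) x) ^ 2 + (deriv (fun s => u₀ x s) y) ^ 2

/-- squared norm of the spatial gradient of `u = u(x,y,t)` -/
noncomputable def gradSqT (u : ℝ → ℝ → ℝ → ℝ) (x y t : ℝ) : ℝ :=
  (deriv (fun s => u s y t) x) ^ 2 + (deriv (fun s => u x s t) y) ^ 2

/-- first component of the Perona–Malik flux `φ'(|∇u|)·∇u/|∇u|` -/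
noncomputable def pmFlux1 (φ : ℝ → ℝ) (u : ℝ → ℝ → ℝ → ℝ) (x y t : ℝ) : ℝ :=
  deriv φ (Real.sqrt (gradSqT u x y t)) * (deriv (fun s => u s y t) x) /
    Real.sqrt (gradSqT u x y t)

/-- second component of the Perona–Malik flux `φ'(|∇u|)·∇u/|∇u|` -/
noncomputable def pmFlux2 (φ : ℝ → ℝ) (u : ℝ → ℝ → ℝ → ℝ) (x y t : ℝ) : ℝ :=
  deriv φ (Real.sqrt (gradSqT u x y t)) * (deriv (fun s => u x s t) y) /
    Real.sqrt (gradSqT u x y t)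

/-- Partial derivative in the first variable of a function on the plane. -/
noncomputable def pdx (F : ℝ × ℝ → ℝ) (z : ℝ × ℝ) : ℝ := fderiv ℝ F z (1, 0)

/-- Partial derivative in the second variable of a function on the plane. -/
noncomputable def pdy (F : ℝ × ℝ → ℝ) (z : ℝ × ℝ) : ℝ := fderiv ℝ F z (0, 1)

lemma contDiffOn_pdx {F : ℝ × ℝ → ℝ} {Ω : Set (ℝ × ℝ)} {m n : WithTop ℕ∞}
    (hF : ContDiffOn ℝ n F Ω) (hΩ : IsOpen Ω) (hmn : m + 1 ≤ n) :
    ContDiffOn ℝ m (pdx F) Ω :=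
  (hF.fderiv_of_isOpen hΩ hmn).clm_apply contDiffOn_const

lemma contDiffOn_pdy {F : ℝ × ℝ → ℝ} {Ω : Set (ℝ × ℝ)} {m n : WithTop ℕ∞}
    (hF : ContDiffOn ℝ n F Ω) (hΩ : IsOpen Ω) (hmn : m + 1 ≤ n) :
    ContDiffOn ℝ m (pdy F) Ω :=
  (hF.fderiv_of_isOpen hΩ hmn).clm_apply contDiffOn_const

lemma DifferentiableAt.hasDerivAt_comp_curve {F : ℝ × ℝ → ℝ} {x y : ℝ → ℝ} {x' y' s : ℝ}
    (hF : DifferentiableAt ℝ F (x s, y s)) (hx : HasDerivAt x x' s) (hy : HasDerivAt y y' s) :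
    HasDerivAt (fun s => F (x s, y s)) (x' * pdx F (x s, y s) + y' * pdy F (x s, y s)) s := by
  have h := hF.hasFDerivAt.comp_hasDerivAt s (hx.prodMk hy)
  have e : ((x', y') : ℝ × ℝ) = x' • ((1 : ℝ), (0 : ℝ)) + y' • ((0 : ℝ), (1 : ℝ)) := by
    ext <;> simp
  rw [e, map_add, map_smul, map_smul] at h
  exact h

lemma pdx_pdy_comm {F : ℝ × ℝ → ℝ} {z : ℝ × ℝ} (hF : ContDiffAt ℝ 2 F z) :
    pdx (pdy F) z = pdy (pdx F) z := by
  have hs : IsSymmSndFDerivAt ℝ F z := hF.isSymmSndFDerivAt (by simp)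
  have hd : DifferentiableAt ℝ (fderiv ℝ F) z :=
    (hF.fderiv_right (m := 1) (by norm_num)).differentiableAt (by norm_num)
  have key (v : ℝ × ℝ) :
      fderiv ℝ (fun z => fderiv ℝ F z v) z = (fderiv ℝ (fderiv ℝ F) z).flip v := by
    rw [fderiv_clm_apply hd (differentiableAt_const v)]
    simp
  unfold pdx pdy
  rw [key, key]
  exact hs _ _

lemma eq_zero_of_isLittleO_pow {c : ℝ} {n : ℕ} {R : ℝ → ℝ} (hR : ContinuousAt R 0)
    (h : (fun s : ℝ => c * s ^ n + s ^ (n + 1) * R s) =o[𝓝 0] fun s => s ^ n) : c = 0 := by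
  have h1 : (fun s : ℝ => s ^ (n + 1) * R s) =o[𝓝 0] fun s => s ^ n := by
    have : (fun s : ℝ => s * R s) =o[𝓝 0] fun _ => (1 : ℝ) := by
      rw [isLittleO_one_iff]
      have h0 : ContinuousAt (fun s => s * R s) 0 := continuousAt_id.mul hR
      simpa using h0.tendsto
    have := (isBigO_refl (fun s : ℝ => s ^ n) (𝓝 0)).mul_isLittleO this
    refine this.congr (fun s => by ring) (fun s => by ring)
  have h2 : (fun s : ℝ => c * s ^ n) =o[𝓝 0] fun s => s ^ n := by
    refine (h.sub h1).congr_left fun s => by ring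
  by_contra hc
  rw [isLittleO_const_mul_left_iff hc] at h2
  refine isLittleO_irrefl ?_ h2
  have : ∃ᶠ s : ℝ in 𝓝[≠] 0, s ∈ ({0}ᶜ : Set ℝ) := eventually_mem_nhdsWithin.frequently
  exact (this.filter_mono nhdsWithin_le_nhds).mono fun s hs => pow_ne_zero _ hs

lemma isLittleO_pow_succ_of_hasDerivAt {f f' : ℝ → ℝ} {n : ℕ}
    (hd : ∀ᶠ s in 𝓝 0, HasDerivAt f (f' s) s) (h : f' =o[𝓝 0] fun s => s ^ n) :
    (fun s => f s - f 0) =o[𝓝 0] fun s => s ^ (n + 1) := by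
  obtain ⟨ε, hε, hb⟩ := Metric.eventually_nhds_iff_ball.1 hd
  have h0 : (0 : ℝ) ∈ Metric.ball (0 : ℝ) ε := Metric.mem_ball_self hε
  have hn := Metric.isOpen_ball.nhdsWithin_eq h0
  have := Convex.isLittleO_pow_succ_real (n := n) (convex_ball (0 : ℝ) ε) h0
    (fun s hs => (hb s hs).hasDerivWithinAt) (by simpa [hn] using h)
  simpa [hn] using this

lemma taylor_three_unique {f f₁ f₂ : ℝ → ℝ} {c a₁ a₂ a₃ : ℝ}
    (h₁ : ∀ᶠ s in 𝓝 0, HasDerivAt f (f₁ s) s) (h₂ : ∀ᶠ s in 𝓝 0, HasDerivAt f₁ (f₂ s) s)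
    (h₃ : HasDerivAt f₂ c 0)
    (ho : (fun s => f s - (a₁ * s + a₂ * s ^ 2 + a₃ * s ^ 3)) =o[𝓝 0] fun s => s ^ 3) :
    f₁ 0 = a₁ ∧ f₂ 0 = 2 * a₂ ∧ c = 6 * a₃ := by
  have e₂ : (fun s => f₂ s - f₂ 0 - c * s) =o[𝓝 0] fun s => s ^ 1 := by
    have := hasDerivAt_iff_isLittleO.1 h₃
    refine this.congr (fun s => by simp; ring) (fun s => by simp)
  have e₁ := isLittleO_pow_succ_of_hasDerivAt
    (f := fun s => f₁ s - f₂ 0 * s - c * (s ^ 2 / 2)) (h₂.mono fun s hs => by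
      refine ((hs.sub ((hasDerivAt_id s).const_mul (f₂ 0))).sub
        (((hasDerivAt_pow 2 s).div_const 2).const_mul c)).congr_deriv ?_
      simp) e₂
  have e₀ := isLittleO_pow_succ_of_hasDerivAt
    (f := fun s => f s - f₁ 0 * s - f₂ 0 * (s ^ 2 / 2) - c * (s ^ 3 / 6))
    (h₁.mono fun s hs => by
      refine (((hs.sub ((hasDerivAt_id s).const_mul (f₁ 0))).sub
        (((hasDerivAt_pow 2 s).div_const 2).const_mul (f₂ 0))).sub
        (((hasDerivAt_pow 3 s).div_const 6).const_mul c)).congr_deriv ?_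
      simp
      ring) e₁
  have e : (fun s => f 0 + (f₁ 0 - a₁) * s + (f₂ 0 / 2 - a₂) * s ^ 2 + (c / 6 - a₃) * s ^ 3)
      =o[𝓝 0] fun s : ℝ => s ^ 3 :=
    (ho.sub e₀).congr_left fun s => by simp; ring
  have le (m : ℕ) (hm : m ≤ 3) : (fun s : ℝ => s ^ 3) =O[𝓝 0] fun s => s ^ m := by
    have hb : (fun s : ℝ => s ^ (3 - m)) =O[𝓝 0] fun _ => (1 : ℝ) :=
      (continuous_pow (3 - m)).continuousAt.tendsto.isBigO_one ℝ
    refine (hb.mul (isBigO_refl (fun s : ℝ => s ^ m) _)).congr (fun s => ?_) (fun s => one_mul _)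
    rw [← pow_add, Nat.sub_add_cancel hm]
  have c0 : f 0 = 0 := eq_zero_of_isLittleO_pow (n := 0)
    (R := fun s => (f₁ 0 - a₁) + (f₂ 0 / 2 - a₂) * s + (c / 6 - a₃) * s ^ 2) (by fun_prop)
    ((e.trans_isBigO (le 0 (by norm_num))).congr_left fun s => by ring)
  have c1 : f₁ 0 - a₁ = 0 := eq_zero_of_isLittleO_pow (n := 1)
    (R := fun s => (f₂ 0 / 2 - a₂) + (c / 6 - a₃) * s) (by fun_prop)
    ((e.trans_isBigO (le 1 (by norm_num))).congr_left fun s => by rw [c0]; ring)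
  have c2 : f₂ 0 / 2 - a₂ = 0 := eq_zero_of_isLittleO_pow (n := 2)
    (R := fun s => (c / 6 - a₃)) (by fun_prop)
    ((e.trans_isBigO (le 2 (by norm_num))).congr_left fun s => by rw [c0, c1]; ring)
  have c3 : c / 6 - a₃ = 0 := eq_zero_of_isLittleO_pow (n := 3)
    (R := fun s => 0) (by fun_prop)
    (e.congr_left fun s => by rw [c0, c1, c2]; ring)
  exact ⟨by linarith, by linarith, by linarith⟩

lemma isBigO_rpow_line (v w : ℝ) :
    (fun s : ℝ => ((s * v) ^ 2 + (s * w) ^ 2) ^ ((3 : ℝ) / 2)) =O[𝓝 0] fun s => s ^ 3 := by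
  refine IsBigO.of_bound ((v ^ 2 + w ^ 2) ^ ((3 : ℝ) / 2)) (Eventually.of_forall fun s => ?_)
  have e : (s * v) ^ 2 + (s * w) ^ 2 = (v ^ 2 + w ^ 2) * |s| ^ 2 := by
    rw [sq_abs]
    ring
  have hs : (|s| ^ 2) ^ ((3 : ℝ) / 2) = |s| ^ 3 := by
    rw [← Real.rpow_natCast, ← Real.rpow_mul (abs_nonneg s), ← Real.rpow_natCast]
    norm_num
  rw [e, Real.mul_rpow (by positivity) (by positivity), hs, norm_mul, norm_pow, norm_pow,
    Real.norm_of_nonneg (by positivity : 0 ≤ (v ^ 2 + w ^ 2) ^ ((3 : ℝ) / 2))]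
  simp

section Jet

variable {U : ℝ × ℝ → ℝ} {Ω : Set (ℝ × ℝ)} {c d k₁ k₂ h₁ h₂ : ℝ}

lemma jet_along_line (hΩ : IsOpen Ω) (h0 : ((0 : ℝ), (0 : ℝ)) ∈ Ω) (hU : ContDiffOn ℝ 3 U Ω)
    (ho : (fun p : ℝ × ℝ => U p - (c * p.1 + d * p.2 + k₁ * p.1 ^ 2 + k₂ * p.2 ^ 2 +
      h₁ * p.1 ^ 3 + h₂ * p.2 ^ 3)) =o[𝓝 ((0 : ℝ), (0 : ℝ))]
        fun p : ℝ × ℝ => (p.1 ^ 2 + p.2 ^ 2) ^ ((3 : ℝ) / 2)) (v w : ℝ) :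
    v * pdx U (0, 0) + w * pdy U (0, 0) = c * v + d * w ∧
    v * (v * pdx (pdx U) (0, 0) + w * pdy (pdx U) (0, 0)) +
      w * (v * pdx (pdy U) (0, 0) + w * pdy (pdy U) (0, 0)) =
        2 * (k₁ * v ^ 2 + k₂ * w ^ 2) ∧
    v * (v * (v * pdx (pdx (pdx U)) (0, 0) + w * pdy (pdx (pdx U)) (0, 0)) +
        w * (v * pdx (pdy (pdx U)) (0, 0) + w * pdy (pdy (pdx U)) (0, 0))) +
      w * (v * (v * pdx (pdx (pdy U)) (0, 0) + w * pdy (pdx (pdy U)) (0, 0)) +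
        w * (v * pdx (pdy (pdy U)) (0, 0) + w * pdy (pdy (pdy U)) (0, 0))) =
        6 * (h₁ * v ^ 3 + h₂ * w ^ 3) := by
  have hγ : Tendsto (fun s : ℝ => (s * v, s * w)) (𝓝 0) (𝓝 ((0 : ℝ), (0 : ℝ))) := by
    have : Continuous fun s : ℝ => (s * v, s * w) := by fun_prop
    simpa using this.tendsto 0
  have hev : ∀ᶠ s : ℝ in 𝓝 0, (s * v, s * w) ∈ Ω := hγ (hΩ.mem_nhds h0)
  have hx (s : ℝ) : HasDerivAt (fun s => s * v) v s := hasDerivAt_mul_const v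
  have hy (s : ℝ) : HasDerivAt (fun s => s * w) w s := hasDerivAt_mul_const w
  have curve {F : ℝ × ℝ → ℝ} (hF : ContDiffOn ℝ 1 F Ω) {s : ℝ} (hs : (s * v, s * w) ∈ Ω) :
      HasDerivAt (fun s => F (s * v, s * w))
        (v * pdx F (s * v, s * w) + w * pdy F (s * v, s * w)) s :=
    ((hF.contDiffAt (hΩ.mem_nhds hs)).differentiableAt (by norm_num)).hasDerivAt_comp_curve
      (hx s) (hy s)
  have hp : ContDiffOn ℝ 2 (pdx U) Ω := contDiffOn_pdx hU hΩ (by norm_num)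
  have hq : ContDiffOn ℝ 2 (pdy U) Ω := contDiffOn_pdy hU hΩ (by norm_num)
  have h12 : (1 : WithTop ℕ∞) + 1 ≤ 2 := by norm_num
  have key := taylor_three_unique (f := fun s => U (s * v, s * w))
    (a₁ := c * v + d * w) (a₂ := k₁ * v ^ 2 + k₂ * w ^ 2) (a₃ := h₁ * v ^ 3 + h₂ * w ^ 3)
    (hev.mono fun s hs => curve (hU.of_le (by norm_num)) hs)
    (hev.mono fun s hs => ((curve (hp.of_le (by norm_num)) hs).const_mul v).add
      ((curve (hq.of_le (by norm_num)) hs).const_mul w))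
    ((((((curve (contDiffOn_pdx hp hΩ h12) hev.self_of_nhds).const_mul v).add
      ((curve (contDiffOn_pdy hp hΩ h12) hev.self_of_nhds).const_mul w))).const_mul v).add
      ((((curve (contDiffOn_pdx hq hΩ h12) hev.self_of_nhds).const_mul v).add
      ((curve (contDiffOn_pdy hq hΩ h12) hev.self_of_nhds).const_mul w)).const_mul w))
    (((ho.comp_tendsto hγ).trans_isBigO (isBigO_rpow_line v w)).congr_left fun s => by
      simp only [Function.comp]
      ring)
  simpa only [zero_mul] using key

lemma jet_values (hΩ : IsOpen Ω) (h0 : ((0 : ℝ), (0 : ℝ)) ∈ Ω) (hU : ContDiffOn ℝ 3 U Ω)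
    (ho : (fun p : ℝ × ℝ => U p - (c * p.1 + d * p.2 + k₁ * p.1 ^ 2 + k₂ * p.2 ^ 2 +
      h₁ * p.1 ^ 3 + h₂ * p.2 ^ 3)) =o[𝓝 ((0 : ℝ), (0 : ℝ))]
        fun p : ℝ × ℝ => (p.1 ^ 2 + p.2 ^ 2) ^ ((3 : ℝ) / 2)) :
    (pdx U (0, 0) = c ∧ pdy U (0, 0) = d) ∧
    (pdx (pdx U) (0, 0) = 2 * k₁ ∧ pdy (pdx U) (0, 0) = 0 ∧
      pdx (pdy U) (0, 0) = 0 ∧ pdy (pdy U) (0, 0) = 2 * k₂) ∧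
    (pdx (pdx (pdx U)) (0, 0) = 6 * h₁ ∧ pdy (pdx (pdx U)) (0, 0) = 0 ∧
      pdx (pdy (pdx U)) (0, 0) = 0 ∧ pdy (pdy (pdx U)) (0, 0) = 0) ∧
    (pdx (pdx (pdy U)) (0, 0) = 0 ∧ pdy (pdx (pdy U)) (0, 0) = 0 ∧
      pdx (pdy (pdy U)) (0, 0) = 0 ∧ pdy (pdy (pdy U)) (0, 0) = 6 * h₂) := by
  have line := jet_along_line hΩ h0 hU ho
  have hn : Ω ∈ 𝓝 ((0 : ℝ), (0 : ℝ)) := hΩ.mem_nhds h0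
  have hp : ContDiffOn ℝ 2 (pdx U) Ω := contDiffOn_pdx hU hΩ (by norm_num)
  have hq : ContDiffOn ℝ 2 (pdy U) Ω := contDiffOn_pdy hU hΩ (by norm_num)
  have sU : pdx (pdy U) =ᶠ[𝓝 ((0 : ℝ), (0 : ℝ))] pdy (pdx U) := by
    filter_upwards [hn] with z hz
    exact pdx_pdy_comm ((hU.contDiffAt (hΩ.mem_nhds hz)).of_le (by norm_num))
  have s0 := sU.self_of_nhds
  have sx : pdx (pdx (pdy U)) (0, 0) = pdx (pdy (pdx U)) (0, 0) := by
    unfold pdx at sU ⊢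
    rw [sU.fderiv_eq]
  have sy : pdy (pdx (pdy U)) (0, 0) = pdy (pdy (pdx U)) (0, 0) := by
    conv_lhs => rw [pdy, sU.fderiv_eq, ← pdy]
  have sp := pdx_pdy_comm (hp.contDiffAt hn)
  have sq := pdx_pdy_comm (hq.contDiffAt hn)
  obtain ⟨a1, a2, a3⟩ := line 1 0
  obtain ⟨b1, b2, b3⟩ := line 0 1
  obtain ⟨-, c2, c3⟩ := line 1 1
  obtain ⟨-, -, d3⟩ := line 1 (-1)
  norm_num at a1 a2 a3 b1 b2 b3 c2 c3 d3
  refine ⟨⟨?_, ?_⟩, ⟨?_, ?_, ?_, ?_⟩, ⟨?_, ?_, ?_, ?_⟩, ?_, ?_, ?_, ?_⟩ <;> linarith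

end Jet

lemma not_isLocalMin_of_second_deriv_neg {f f₁ : ℝ → ℝ} {s₀ c : ℝ}
    (h₁ : ∀ᶠ s in 𝓝 s₀, HasDerivAt f (f₁ s) s) (h₂ : HasDerivAt f₁ c s₀) (hc : c < 0) :
    ¬ IsLocalMin f s₀ := by
  intro hmin
  have e : deriv f =ᶠ[𝓝 s₀] f₁ := h₁.mono fun s hs => hs.deriv
  have h2 : deriv (deriv f) s₀ = c := by rw [e.deriv_eq, h₂.deriv]
  have hmax : IsLocalMax f s₀ := isLocalMax_of_deriv_deriv_neg (by rwa [h2]) hmin.deriv_eq_zero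
    h₁.self_of_nhds.continuousAt
  have hconst : f =ᶠ[𝓝 s₀] fun _ => f s₀ := by
    filter_upwards [hmin, hmax] with s ha hb using le_antisymm hb ha
  have h3 : deriv (deriv f) s₀ = 0 := by
    rw [hconst.deriv.deriv_eq]
    simp
  linarith

/-- If the tangential second derivative of `G` is negative throughout a convex set where
`∂G/∂y > 0`, then superlevel sets of `G` are convex along non-vertical segments. -/
lemma le_on_segment {G : ℝ × ℝ → ℝ} {V : Set (ℝ × ℝ)} (hV : Convex ℝ V)
    (hG : ∀ z ∈ V, ContDiffAt ℝ 2 G z) (hy : ∀ z ∈ V, 0 < pdy G z)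
    (hK : ∀ z ∈ V, pdx (pdx G) z + (-pdx G z / pdy G z) * (pdy (pdx G) z + pdx (pdy G) z) +
      (-pdx G z / pdy G z) ^ 2 * pdy (pdy G) z < 0)
    {x₁ y₁ x₂ y₂ ℓ : ℝ} (hx : x₁ ≠ x₂) (h₁ : (x₁, y₁) ∈ V) (h₂ : (x₂, y₂) ∈ V)
    (hG₁ : G (x₁, y₁) = ℓ) (hG₂ : G (x₂, y₂) = ℓ) {s : ℝ} (hs : s ∈ Set.Icc (0 : ℝ) 1) :
    ℓ ≤ G (x₁ + s * (x₂ - x₁), y₁ + s * (y₂ - y₁)) := by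
  set v := x₂ - x₁ with hv
  set w := y₂ - y₁ with hw
  have hv0 : v ≠ 0 := sub_ne_zero.2 hx.symm
  have mem {s : ℝ} (hs : s ∈ Set.Icc (0 : ℝ) 1) : (x₁ + s * v, y₁ + s * w) ∈ V := by
    have := hV.add_smul_sub_mem h₁ h₂ hs
    simpa using this
  have curve {F : ℝ × ℝ → ℝ} {s : ℝ} (hF : DifferentiableAt ℝ F (x₁ + s * v, y₁ + s * w)) :
      HasDerivAt (fun s => F (x₁ + s * v, y₁ + s * w))
        (v * pdx F (x₁ + s * v, y₁ + s * w) + w * pdy F (x₁ + s * v, y₁ + s * w)) s :=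
    hF.hasDerivAt_comp_curve ((hasDerivAt_mul_const v).const_add x₁)
      ((hasDerivAt_mul_const w).const_add y₁)
  have d1 {s : ℝ} (hs : s ∈ Set.Icc (0 : ℝ) 1) :=
    curve ((hG _ (mem hs)).differentiableAt (by norm_num))
  obtain ⟨s₀, hs₀, hmin⟩ := isCompact_Icc.exists_isMinOn (Set.nonempty_Icc.2 zero_le_one)
    (f := fun s => G (x₁ + s * v, y₁ + s * w))
    (fun s hs => (d1 hs).continuousAt.continuousWithinAt)
  refine le_trans ?_ (hmin hs)
  show ℓ ≤ G (x₁ + s₀ * v, y₁ + s₀ * w)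
  by_contra! hlt
  have hne0 : s₀ ≠ 0 := by
    rintro rfl
    simp [hG₁] at hlt
  have hne1 : s₀ ≠ 1 := by
    rintro rfl
    simp [hv, hw, hG₂] at hlt
  have hnhds : Set.Icc (0 : ℝ) 1 ∈ 𝓝 s₀ :=
    Icc_mem_nhds (lt_of_le_of_ne hs₀.1 hne0.symm) (lt_of_le_of_ne hs₀.2 hne1)
  have hloc := hmin.isLocalMin hnhds
  have hz := mem hs₀
  have hcrit := hloc.hasDerivAt_eq_zero (d1 hs₀)
  have hD : ContDiffAt ℝ 1 (fderiv ℝ G) (x₁ + s₀ * v, y₁ + s₀ * w) :=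
    (hG _ hz).fderiv_right (by norm_num)
  have hdx : DifferentiableAt ℝ (pdx G) (x₁ + s₀ * v, y₁ + s₀ * w) :=
    (hD.clm_apply contDiffAt_const).differentiableAt (by norm_num)
  have hdy : DifferentiableAt ℝ (pdy G) (x₁ + s₀ * v, y₁ + s₀ * w) :=
    (hD.clm_apply contDiffAt_const).differentiableAt (by norm_num)
  refine not_isLocalMin_of_second_deriv_neg (Filter.eventually_of_mem hnhds fun s hs => d1 hs)
    (((curve hdx).const_mul v).add ((curve hdy).const_mul w)) ?_ hloc
  have hyz := hy _ hz
  have hKz := hK _ hz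
  set z := (x₁ + s₀ * v, y₁ + s₀ * w)
  set m := -pdx G z / pdy G z with hm
  have hwm : w = m * v := by
    rw [hm]
    field_simp
    linarith
  have hvv : 0 < v ^ 2 := by positivity
  calc _ = v ^ 2 * (pdx (pdx G) z + m * (pdy (pdx G) z + pdx (pdy G) z) +
        m ^ 2 * pdy (pdy G) z) := by
        rw [hwm]
        ring
    _ < 0 := mul_neg_of_pos_of_neg hvv hKz

lemma exists_convexOn_superlevel {G : ℝ × ℝ → ℝ} {Ω : Set (ℝ × ℝ)} {ℓ : ℝ} (hΩ : IsOpen Ω)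
    (h0 : ((0 : ℝ), (0 : ℝ)) ∈ Ω) (hG : ContDiffOn ℝ 2 G Ω) (hG0 : G (0, 0) = ℓ)
    (hx : pdx G (0, 0) = 0) (hy : 0 < pdy G (0, 0)) (hxx : pdx (pdx G) (0, 0) < 0) :
    ∃ δ > (0 : ℝ), ∃ a > (0 : ℝ), ∃ g : ℝ → ℝ,
      Set.Ioo (-δ) δ ×ˢ Set.Ioo (-a) a ⊆ Ω ∧ ConvexOn ℝ (Set.Ioo (-δ) δ) g ∧
      (∀ x ∈ Set.Ioo (-δ) δ, g x ∈ Set.Ioo (-a) a) ∧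
      ∀ x y : ℝ, x ∈ Set.Ioo (-δ) δ → y ∈ Set.Ioo (-a) a → (ℓ < G (x, y) ↔ g x < y) := by
  have hn : Ω ∈ 𝓝 ((0 : ℝ), (0 : ℝ)) := hΩ.mem_nhds h0
  have h12 : (1 : WithTop ℕ∞) + 1 ≤ 2 := by norm_num
  have h01 : (0 : WithTop ℕ∞) + 1 ≤ 1 := by norm_num
  have dGx := contDiffOn_pdx hG hΩ h12
  have dGy := contDiffOn_pdy hG hΩ h12
  have c1 := dGx.continuousOn.continuousAt hn
  have c2 := dGy.continuousOn.continuousAt hn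
  have c11 := (contDiffOn_pdx dGx hΩ h01).continuousOn.continuousAt hn
  have c12 := (contDiffOn_pdy dGx hΩ h01).continuousOn.continuousAt hn
  have c21 := (contDiffOn_pdx dGy hΩ h01).continuousOn.continuousAt hn
  have c22 := (contDiffOn_pdy dGy hΩ h01).continuousOn.continuousAt hn
  have cm : ContinuousAt (fun z => -pdx G z / pdy G z) ((0 : ℝ), (0 : ℝ)) := c1.neg.div c2 hy.ne'
  have cK : ContinuousAt (fun z => pdx (pdx G) z +
      (-pdx G z / pdy G z) * (pdy (pdx G) z + pdx (pdy G) z) +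
      (-pdx G z / pdy G z) ^ 2 * pdy (pdy G) z) ((0 : ℝ), (0 : ℝ)) :=
    (c11.add (cm.mul (c12.add c21))).add ((cm.pow 2).mul c22)
  have evK := cK.tendsto.eventually_lt_const (u := 0) (by simpa [hx] using hxx)
  have evy := c2.tendsto.eventually_const_lt (u := 0) hy
  obtain ⟨ε, hε, hball⟩ := Metric.eventually_nhds_iff_ball.1
    ((show ∀ᶠ z in 𝓝 ((0 : ℝ), (0 : ℝ)), z ∈ Ω from hn).and (evy.and evK))
  have hprod : Metric.ball ((0 : ℝ), (0 : ℝ)) ε = Set.Ioo (-ε) ε ×ˢ Set.Ioo (-ε) ε := by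
    rw [← ball_prod_same, Real.ball_eq_Ioo]
    simp
  rw [hprod] at hball
  have hmono {x : ℝ} (hx : x ∈ Set.Ioo (-ε) ε) :
      StrictMonoOn (fun y => G (x, y)) (Set.Ioo (-ε) ε) := by
    have hd : ∀ y ∈ Set.Ioo (-ε) ε, HasDerivAt (fun y => G (x, y)) (pdy G (x, y)) y := by
      intro y hy
      have := (((hG.contDiffAt (hΩ.mem_nhds (hball (x, y) ⟨hx, hy⟩).1)).differentiableAt
        (by norm_num))).hasDerivAt_comp_curve (hasDerivAt_const y x) (hasDerivAt_id y)
      simpa using this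
    refine strictMonoOn_of_deriv_pos (convex_Ioo _ _)
      (fun y hy => (hd y hy).continuousAt.continuousWithinAt) fun y hy => ?_
    rw [interior_Ioo] at hy
    rw [(hd y hy).deriv]
    exact (hball (x, y) ⟨hx, hy⟩).2.1
  have m0 : (0 : ℝ) ∈ Set.Ioo (-ε) ε := ⟨by linarith, hε⟩
  have mp : ε / 2 ∈ Set.Ioo (-ε) ε := ⟨by linarith, by linarith⟩
  have mn : -(ε / 2) ∈ Set.Ioo (-ε) ε := ⟨by linarith, by linarith⟩
  have cslice (y : ℝ) (hy : y ∈ Set.Ioo (-ε) ε) : ContinuousAt (fun x => G (x, y)) 0 := by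
    have h : ContinuousAt G ((0 : ℝ), y) :=
      hG.continuousOn.continuousAt (hΩ.mem_nhds (hball (0, y) ⟨m0, hy⟩).1)
    exact ContinuousAt.comp (f := fun x : ℝ => (x, y)) h (by fun_prop)
  have evp := (cslice _ mp).tendsto.eventually_const_lt (u := ℓ)
    (hG0 ▸ hmono m0 m0 mp (by linarith : (0 : ℝ) < ε / 2))
  have evn := (cslice _ mn).tendsto.eventually_lt_const (u := ℓ)
    (hG0 ▸ hmono m0 mn m0 (by linarith : -(ε / 2) < (0 : ℝ)))
  obtain ⟨δ', hδ', hb'⟩ := Metric.eventually_nhds_iff_ball.1 (evp.and evn)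
  rw [Real.ball_eq_Ioo, zero_sub, zero_add] at hb'
  set δ := min δ' ε
  have hδ : 0 < δ := lt_min hδ' hε
  have sub' : Set.Ioo (-δ) δ ⊆ Set.Ioo (-δ') δ' :=
    Set.Ioo_subset_Ioo (neg_le_neg (min_le_left _ _)) (min_le_left _ _)
  have sub : Set.Ioo (-δ) δ ⊆ Set.Ioo (-ε) ε :=
    Set.Ioo_subset_Ioo (neg_le_neg (min_le_right _ _)) (min_le_right _ _)
  have hex : ∀ x : ℝ, ∃ y, x ∈ Set.Ioo (-δ) δ → y ∈ Set.Ioo (-ε) ε ∧ G (x, y) = ℓ := by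
    intro x
    by_cases hx : x ∈ Set.Ioo (-δ) δ
    swap
    · exact ⟨0, fun h => absurd h hx⟩
    have hIcc : Set.Icc (-(ε / 2)) (ε / 2) ⊆ Set.Ioo (-ε) ε := fun y hy =>
      ⟨mn.1.trans_le hy.1, hy.2.trans_lt mp.2⟩
    have hc : ContinuousOn (fun y => G (x, y)) (Set.Icc (-(ε / 2)) (ε / 2)) := by
      intro y hy
      have h : ContinuousAt G (x, y) :=
        hG.continuousOn.continuousAt (hΩ.mem_nhds (hball (x, y) ⟨sub hx, hIcc hy⟩).1)
      exact (ContinuousAt.comp (f := fun y : ℝ => (x, y)) h (by fun_prop)).continuousWithinAt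
    obtain ⟨y, hy, hyℓ⟩ := intermediate_value_Icc (by linarith : -(ε / 2) ≤ ε / 2) hc
      ⟨(hb' x (sub' hx)).2.le, (hb' x (sub' hx)).1.le⟩
    exact ⟨y, fun _ => ⟨hIcc hy, hyℓ⟩⟩
  choose g hg using hex
  refine ⟨δ, hδ, ε, hε, g, fun z hz => (hball z ⟨sub hz.1, hz.2⟩).1, ⟨convex_Ioo _ _, ?_⟩,
    fun x hx => (hg x hx).1, fun x y hx hy => ?_⟩
  · intro x₁ hx₁ x₂ hx₂ a b ha hb hab
    rcases eq_or_ne x₁ x₂ with rfl | hne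
    · rw [← add_smul, ← add_smul, hab, one_smul, one_smul]
    have hseg := le_on_segment (V := Set.Ioo (-ε) ε ×ˢ Set.Ioo (-ε) ε)
      ((convex_Ioo _ _).prod (convex_Ioo _ _))
      (fun z hz => hG.contDiffAt (hΩ.mem_nhds (hball z hz).1))
      (fun z hz => (hball z hz).2.1) (fun z hz => (hball z hz).2.2) hne
      ⟨sub hx₁, (hg x₁ hx₁).1⟩ ⟨sub hx₂, (hg x₂ hx₂).1⟩ (hg x₁ hx₁).2 (hg x₂ hx₂).2
      (s := b) ⟨hb, by linarith⟩
    have ex : x₁ + b * (x₂ - x₁) = a • x₁ + b • x₂ := by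
      simp only [smul_eq_mul]
      linear_combination (-x₁) * hab
    have ey : g x₁ + b * (g x₂ - g x₁) = a • g x₁ + b • g x₂ := by
      simp only [smul_eq_mul]
      linear_combination (-g x₁) * hab
    rw [ex, ey] at hseg
    have hxm : a • x₁ + b • x₂ ∈ Set.Ioo (-δ) δ := convex_Ioo _ _ hx₁ hx₂ ha hb hab
    have hym : a • g x₁ + b • g x₂ ∈ Set.Ioo (-ε) ε :=
      convex_Ioo _ _ (hg x₁ hx₁).1 (hg x₂ hx₂).1 ha hb hab
    obtain ⟨hm₁, hm₂⟩ := hg _ hxm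
    rw [← hm₂] at hseg
    exact ((hmono (sub hxm)).le_iff_le hm₁ hym).1 hseg
  · obtain ⟨hm₁, hm₂⟩ := hg x hx
    rw [← hm₂]
    exact (hmono (sub hx)).lt_iff_lt hm₁ hy

section Partials

variable {F p q r w : ℝ × ℝ → ℝ} {z : ℝ × ℝ} {x y : ℝ}

lemma DifferentiableAt.hasDerivAt_fst (hF : DifferentiableAt ℝ F (x, y)) :
    HasDerivAt (fun s => F (s, y)) (pdx F (x, y)) x := by
  simpa using hF.hasDerivAt_comp_curve (hasDerivAt_id x) (hasDerivAt_const x y)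

lemma DifferentiableAt.hasDerivAt_snd (hF : DifferentiableAt ℝ F (x, y)) :
    HasDerivAt (fun s => F (x, s)) (pdy F (x, y)) y := by
  simpa using hF.hasDerivAt_comp_curve (hasDerivAt_const y x) (hasDerivAt_id y)

lemma pdx_sq_add_sq (hp : DifferentiableAt ℝ p z) (hq : DifferentiableAt ℝ q z) :
    pdx (fun z => p z ^ 2 + q z ^ 2) z = 2 * (p z * pdx p z + q z * pdx q z) := by
  refine (((hp.pow 2).add (hq.pow 2)).hasDerivAt_fst.unique
    ((hp.hasDerivAt_fst.pow 2).add (hq.hasDerivAt_fst.pow 2))).trans ?_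
  simp
  ring

lemma pdy_sq_add_sq (hp : DifferentiableAt ℝ p z) (hq : DifferentiableAt ℝ q z) :
    pdy (fun z => p z ^ 2 + q z ^ 2) z = 2 * (p z * pdy p z + q z * pdy q z) := by
  refine (((hp.pow 2).add (hq.pow 2)).hasDerivAt_snd.unique
    ((hp.hasDerivAt_snd.pow 2).add (hq.hasDerivAt_snd.pow 2))).trans ?_
  simp
  ring

lemma pdx_mul_add_mul (hp : DifferentiableAt ℝ p z) (hq : DifferentiableAt ℝ q z)
    (hr : DifferentiableAt ℝ r z) (hw : DifferentiableAt ℝ w z) :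
    pdx (fun z => 2 * (p z * r z + q z * w z)) z =
      2 * (pdx p z * r z + p z * pdx r z + (pdx q z * w z + q z * pdx w z)) :=
  ((((hp.mul hr).add (hq.mul hw)).const_mul 2).hasDerivAt_fst).unique
    (((hp.hasDerivAt_fst.mul hr.hasDerivAt_fst).add
      (hq.hasDerivAt_fst.mul hw.hasDerivAt_fst)).const_mul 2)

lemma pdy_mul_add_mul (hp : DifferentiableAt ℝ p z) (hq : DifferentiableAt ℝ q z)
    (hr : DifferentiableAt ℝ r z) (hw : DifferentiableAt ℝ w z) :
    pdy (fun z => 2 * (p z * r z + q z * w z)) z =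
      2 * (pdy p z * r z + p z * pdy r z + (pdy q z * w z + q z * pdy w z)) :=
  ((((hp.mul hr).add (hq.mul hw)).const_mul 2).hasDerivAt_snd).unique
    (((hp.hasDerivAt_snd.mul hr.hasDerivAt_snd).add
      (hq.hasDerivAt_snd.mul hw.hasDerivAt_snd)).const_mul 2)

end Partials

lemma Filter.EventuallyEq.pdx_eq {F G : ℝ × ℝ → ℝ} {z : ℝ × ℝ} (h : F =ᶠ[𝓝 z] G) :
    pdx F z = pdx G z := by
  rw [pdx, h.fderiv_eq, ← pdx]

lemma Filter.EventuallyEq.pdy_eq {F G : ℝ × ℝ → ℝ} {z : ℝ × ℝ} (h : F =ᶠ[𝓝 z] G) :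
    pdy F z = pdy G z := by
  rw [pdy, h.fderiv_eq, ← pdy]

/-- The squared norm of the gradient of a function on the plane. -/
noncomputable def normGradSq (U : ℝ × ℝ → ℝ) (z : ℝ × ℝ) : ℝ := pdx U z ^ 2 + pdy U z ^ 2

/-- The diffusivity `φ'(√r)/√r` as a function of the squared gradient norm `r`. -/
noncomputable def diffusivity (φ : ℝ → ℝ) (r : ℝ) : ℝ := deriv φ (Real.sqrt r) / Real.sqrt r

section NormGradSq

variable {U : ℝ × ℝ → ℝ} {Ω : Set (ℝ × ℝ)}

lemma contDiffOn_normGradSq (hΩ : IsOpen Ω) (hU : ContDiffOn ℝ 3 U Ω) :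
    ContDiffOn ℝ 2 (normGradSq U) Ω :=
  ((contDiffOn_pdx hU hΩ (by norm_num)).pow 2).add ((contDiffOn_pdy hU hΩ (by norm_num)).pow 2)

/-- First and second derivatives at the origin of `|∇U|²`, when the Hessian of `U` at the origin is
`diag(0, k)` and the only nonzero third derivatives there are the pure ones. -/
lemma normGradSq_derivs {c k A D : ℝ} (hΩ : IsOpen Ω) (h0 : ((0 : ℝ), (0 : ℝ)) ∈ Ω)
    (hU : ContDiffOn ℝ 3 U Ω)
    (h₁ : pdx U (0, 0) = c ∧ pdy U (0, 0) = c)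
    (h₂ : pdx (pdx U) (0, 0) = 0 ∧ pdy (pdx U) (0, 0) = 0 ∧
      pdx (pdy U) (0, 0) = 0 ∧ pdy (pdy U) (0, 0) = k)
    (h₃ : pdx (pdx (pdx U)) (0, 0) = A ∧ pdy (pdx (pdx U)) (0, 0) = 0 ∧
      pdx (pdy (pdx U)) (0, 0) = 0 ∧ pdy (pdy (pdx U)) (0, 0) = 0)
    (h₄ : pdx (pdx (pdy U)) (0, 0) = 0 ∧ pdy (pdx (pdy U)) (0, 0) = 0 ∧
      pdx (pdy (pdy U)) (0, 0) = 0 ∧ pdy (pdy (pdy U)) (0, 0) = D) :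
    (pdx (normGradSq U) (0, 0) = 0 ∧ pdy (normGradSq U) (0, 0) = 2 * c * k) ∧
    (pdx (pdx (normGradSq U)) (0, 0) = 2 * c * A ∧ pdy (pdx (normGradSq U)) (0, 0) = 0 ∧
      pdx (pdy (normGradSq U)) (0, 0) = 0 ∧
      pdy (pdy (normGradSq U)) (0, 0) = 2 * (k ^ 2 + c * D)) := by
  have hp : ContDiffOn ℝ 2 (pdx U) Ω := contDiffOn_pdx hU hΩ (by norm_num)
  have hq : ContDiffOn ℝ 2 (pdy U) Ω := contDiffOn_pdy hU hΩ (by norm_num)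
  have h12 : (1 : WithTop ℕ∞) + 1 ≤ 2 := by norm_num
  have diff {F : ℝ × ℝ → ℝ} (hF : ContDiffOn ℝ 1 F Ω) {z : ℝ × ℝ} (hz : z ∈ Ω) :
      DifferentiableAt ℝ F z :=
    (hF.contDiffAt (hΩ.mem_nhds hz)).differentiableAt (by norm_num)
  have dp {z : ℝ × ℝ} (hz : z ∈ Ω) := diff (hp.of_le (by norm_num)) hz
  have dq {z : ℝ × ℝ} (hz : z ∈ Ω) := diff (hq.of_le (by norm_num)) hz
  have dpx := diff (contDiffOn_pdx hp hΩ h12) h0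
  have dpy := diff (contDiffOn_pdy hp hΩ h12) h0
  have dqx := diff (contDiffOn_pdx hq hΩ h12) h0
  have dqy := diff (contDiffOn_pdy hq hΩ h12) h0
  have ex : pdx (normGradSq U) =ᶠ[𝓝 ((0 : ℝ), (0 : ℝ))]
      fun z => 2 * (pdx U z * pdx (pdx U) z + pdy U z * pdx (pdy U) z) := by
    filter_upwards [hΩ.mem_nhds h0] with z hz using pdx_sq_add_sq (dp hz) (dq hz)
  have ey : pdy (normGradSq U) =ᶠ[𝓝 ((0 : ℝ), (0 : ℝ))]
      fun z => 2 * (pdx U z * pdy (pdx U) z + pdy U z * pdy (pdy U) z) := by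
    filter_upwards [hΩ.mem_nhds h0] with z hz using pdy_sq_add_sq (dp hz) (dq hz)
  obtain ⟨p0, q0⟩ := h₁
  obtain ⟨px, py, qx, qy⟩ := h₂
  obtain ⟨pxx, pxy, pyx, pyy⟩ := h₃
  obtain ⟨qxx, qxy, qyx, qyy⟩ := h₄
  refine ⟨⟨?_, ?_⟩, ?_, ?_, ?_, ?_⟩
  · refine ex.self_of_nhds.trans ?_
    simp only [px, qx]
    ring
  · refine ey.self_of_nhds.trans ?_
    simp only [py, qy, q0]
    ring
  · rw [ex.pdx_eq, pdx_mul_add_mul (dp h0) (dq h0) dpx dqx, p0, q0, px, qx, pxx, qxx]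
    ring
  · rw [ex.pdy_eq, pdy_mul_add_mul (dp h0) (dq h0) dpx dqx, p0, q0, px, qx, py, qy, pxy, qxy]
    ring
  · rw [ey.pdx_eq, pdx_mul_add_mul (dp h0) (dq h0) dpy dqy, p0, q0, px, qx, py, qy, pyx, qyx]
    ring
  · rw [ey.pdy_eq, pdy_mul_add_mul (dp h0) (dq h0) dpy dqy, p0, q0, py, qy, pyy, qyy]
    ring

end NormGradSq

section Diffusivity

variable {φ : ℝ → ℝ}

lemma contDiffOn_diffusivity (hφ : ContDiff ℝ (⊤ : ℕ∞) φ) :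
    ContDiffOn ℝ 2 (diffusivity φ) (Set.Ioi 0) := by
  have hd : ContDiff ℝ 2 (deriv φ) :=
    contDiff_infty.1 (contDiff_infty_iff_deriv.1 hφ).2 2
  have hs : ContDiffOn ℝ 2 Real.sqrt (Set.Ioi 0) := fun r hr =>
    (Real.contDiffAt_sqrt (ne_of_gt hr)).contDiffWithinAt
  exact (hd.comp_contDiffOn hs).div hs fun r hr => (Real.sqrt_pos.2 hr).ne'

lemma differentiableAt_diffusivity (hφ : ContDiff ℝ (⊤ : ℕ∞) φ) {r : ℝ} (hr : 0 < r) :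
    DifferentiableAt ℝ (diffusivity φ) r :=
  ((contDiffOn_diffusivity hφ).contDiffAt (Ioi_mem_nhds hr)).differentiableAt (by norm_num)

lemma differentiableAt_deriv_diffusivity (hφ : ContDiff ℝ (⊤ : ℕ∞) φ) {r : ℝ} (hr : 0 < r) :
    DifferentiableAt ℝ (deriv (diffusivity φ)) r :=
  (((contDiffOn_diffusivity hφ).deriv_of_isOpen (m := 1) isOpen_Ioi (by norm_num)).contDiffAt
    (Ioi_mem_nhds hr)).differentiableAt (by norm_num)

lemma diffusivity_one : diffusivity φ 1 = deriv φ 1 := by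
  simp [diffusivity]

lemma deriv_diffusivity_one (hφ : ContDiff ℝ (⊤ : ℕ∞) φ) (h : deriv (deriv φ) 1 = 0) :
    deriv (diffusivity φ) 1 = -deriv φ 1 / 2 := by
  have hd : HasDerivAt (deriv φ) 0 (Real.sqrt 1) := by
    have : Differentiable ℝ (deriv φ) :=
      (contDiff_infty_iff_deriv.1 hφ).2.differentiable (by simp)
    rw [Real.sqrt_one, ← h]
    exact (this 1).hasDerivAt
  have hs := Real.hasDerivAt_sqrt (one_ne_zero (α := ℝ))
  have := (hd.comp 1 hs).div hs (by simp)
  refine this.deriv.trans ?_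
  simp
  ring

end Diffusivity

/-- The right-hand side of the Perona–Malik equation, written out by the product rule. -/
noncomputable def pmOperator (φ : ℝ → ℝ) (U : ℝ × ℝ → ℝ) (z : ℝ × ℝ) : ℝ :=
  deriv (diffusivity φ) (normGradSq U z) *
      (pdx (normGradSq U) z * pdx U z + pdy (normGradSq U) z * pdy U z) +
    diffusivity φ (normGradSq U z) * (pdx (pdx U) z + pdy (pdy U) z)

lemma hasDerivAt_pmOperator_diagonal {φ : ℝ → ℝ} (hφ : ContDiff ℝ (⊤ : ℕ∞) φ)
    {U : ℝ × ℝ → ℝ} {Ω : Set (ℝ × ℝ)} {c k A D : ℝ} (hΩ : IsOpen Ω)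
    (h0 : ((0 : ℝ), (0 : ℝ)) ∈ Ω) (hU : ContDiffOn ℝ 3 U Ω) (hc : c ^ 2 = 1 / 2)
    (h₁ : pdx U (0, 0) = c ∧ pdy U (0, 0) = c)
    (h₂ : pdx (pdx U) (0, 0) = 0 ∧ pdy (pdx U) (0, 0) = 0 ∧
      pdx (pdy U) (0, 0) = 0 ∧ pdy (pdy U) (0, 0) = k)
    (h₃ : pdx (pdx (pdx U)) (0, 0) = A ∧ pdy (pdx (pdx U)) (0, 0) = 0 ∧
      pdx (pdy (pdx U)) (0, 0) = 0 ∧ pdy (pdy (pdx U)) (0, 0) = 0)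
    (h₄ : pdx (pdx (pdy U)) (0, 0) = 0 ∧ pdy (pdx (pdy U)) (0, 0) = 0 ∧
      pdx (pdy (pdy U)) (0, 0) = 0 ∧ pdy (pdy (pdy U)) (0, 0) = D) :
    HasDerivAt (fun s => pmOperator φ U (s, s))
      (2 * c * k ^ 2 * deriv (deriv (diffusivity φ)) 1 +
        deriv (diffusivity φ) 1 * (A + D + 6 * c * k ^ 2) + diffusivity φ 1 * (A + D)) 0 := by
  have hp : ContDiffOn ℝ 2 (pdx U) Ω := contDiffOn_pdx hU hΩ (by norm_num)
  have hq : ContDiffOn ℝ 2 (pdy U) Ω := contDiffOn_pdy hU hΩ (by norm_num)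
  have hG := contDiffOn_normGradSq hΩ hU
  have h12 : (1 : WithTop ℕ∞) + 1 ≤ 2 := by norm_num
  have diag {F : ℝ × ℝ → ℝ} (hF : ContDiffOn ℝ 1 F Ω) :
      HasDerivAt (fun s : ℝ => F (s, s)) (pdx F (0, 0) + pdy F (0, 0)) 0 := by
    have := ((hF.contDiffAt (hΩ.mem_nhds h0)).differentiableAt
      (by norm_num)).hasDerivAt_comp_curve (hasDerivAt_id (0 : ℝ)) (hasDerivAt_id (0 : ℝ))
    simpa using this
  obtain ⟨⟨Gx, Gy⟩, Gxx, Gxy, Gyx, Gyy⟩ := normGradSq_derivs hΩ h0 hU h₁ h₂ h₃ h₄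
  have dp := diag (hp.of_le (by norm_num))
  have dq := diag (hq.of_le (by norm_num))
  have dG := diag (hG.of_le (by norm_num))
  have dpx := diag (contDiffOn_pdx hp hΩ h12)
  have dqy := diag (contDiffOn_pdy hq hΩ h12)
  have dGx := diag (contDiffOn_pdx hG hΩ h12)
  have dGy := diag (contDiffOn_pdy hG hΩ h12)
  obtain ⟨p0, q0⟩ := h₁
  obtain ⟨px, py, qx, qy⟩ := h₂
  obtain ⟨pxx, pxy, -, -⟩ := h₃
  obtain ⟨-, -, qyx, qyy⟩ := h₄
  have G0 : normGradSq U (0, 0) = 1 := by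
    rw [normGradSq, p0, q0]
    linarith
  have pos : 0 < normGradSq U (0, 0) := by rw [G0]; exact one_pos
  have dB := (differentiableAt_diffusivity hφ pos).hasDerivAt.comp (0 : ℝ) dG
  have dB' := (differentiableAt_deriv_diffusivity hφ pos).hasDerivAt.comp (0 : ℝ) dG
  refine ((dB'.mul ((dGx.mul dp).add (dGy.mul dq))).add (dB.mul (dpx.add dqy))).congr_deriv ?_
  simp only [Function.comp, Pi.add_apply, Pi.mul_apply, G0, p0, q0, px, py, qx, qy, pxx, pxy, qyx,
    qyy, Gx, Gy, Gxx, Gxy, Gyx, Gyy]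
  linear_combination (4 * c * k ^ 2 * deriv (deriv (diffusivity φ)) 1 +
    2 * deriv (diffusivity φ) 1 * (A + D)) * hc

section Evolution

variable {Ω : Set (ℝ × ℝ)} {T : ℝ}

/-- The parabolic cylinder `Ω × [0,T)`. -/
def cylinder (Ω : Set (ℝ × ℝ)) (T : ℝ) : Set (ℝ × ℝ × ℝ) :=
  {p : ℝ × ℝ × ℝ | (p.1, p.2.1) ∈ Ω ∧ p.2.2 ∈ Set.Ico 0 T}

lemma uniqueDiffOn_cylinder (hΩ : IsOpen Ω) : UniqueDiffOn ℝ (cylinder Ω T) := by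
  have h := hΩ.uniqueDiffOn.prod (uniqueDiffOn_Ico (0 : ℝ) T) (𝕜 := ℝ)
  exact (ContinuousLinearEquiv.prodAssoc ℝ ℝ ℝ ℝ).symm.uniqueDiffOn_preimage_iff.2 h

lemma mem_closure_interior_cylinder (hΩ : IsOpen Ω) (hT : 0 < T)
    (h0 : ((0 : ℝ), (0 : ℝ)) ∈ Ω) :
    ((0 : ℝ), (0 : ℝ), (0 : ℝ)) ∈ closure (interior (cylinder Ω T)) := by
  have hsub : {p : ℝ × ℝ × ℝ | (p.1, p.2.1) ∈ Ω ∧ p.2.2 ∈ Set.Ioo 0 T} ⊆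
      interior (cylinder Ω T) := by
    refine interior_maximal (fun p hp => ⟨hp.1, Set.Ioo_subset_Ico_self hp.2⟩) ?_
    exact (hΩ.preimage (by fun_prop : Continuous fun p : ℝ × ℝ × ℝ => (p.1, p.2.1))).inter
      (isOpen_Ioo.preimage (by fun_prop : Continuous fun p : ℝ × ℝ × ℝ => p.2.2))
  have hlim : Tendsto (fun t : ℝ => ((0 : ℝ), (0 : ℝ), t)) (𝓝[>] 0)
      (𝓝 ((0 : ℝ), (0 : ℝ), (0 : ℝ))) := by
    have : Continuous fun t : ℝ => ((0 : ℝ), (0 : ℝ), t) := by fun_prop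
    exact (this.tendsto 0).mono_left nhdsWithin_le_nhds
  refine mem_closure_of_tendsto hlim ?_
  filter_upwards [Ioo_mem_nhdsGT hT] with t ht using hsub ⟨h0, ht⟩

/-- For a `C²` function of `(x, y, t)` on `Ω × [0,T)`, the time derivative of `u_x + u_y` at the
origin is the derivative of `u_t` along the diagonal. -/
lemma hasDerivWithinAt_gradient {u : ℝ → ℝ → ℝ → ℝ} {R : ℝ → ℝ} {r : ℝ} (hΩ : IsOpen Ω)
    (h0 : ((0 : ℝ), (0 : ℝ)) ∈ Ω) (hT : 0 < T)
    (hu : ContDiffOn ℝ 2 (fun p : ℝ × ℝ × ℝ => u p.1 p.2.1 p.2.2) (cylinder Ω T))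
    (hR : ∀ᶠ s in 𝓝 0, HasDerivWithinAt (fun t => u s s t) (R s) (Set.Ico 0 T) 0)
    (hr : HasDerivAt R r 0) :
    ∃ p' q' : ℝ,
      HasDerivWithinAt (fun t => deriv (fun s => u s 0 t) 0) p' (Set.Ico 0 T) 0 ∧
      HasDerivWithinAt (fun t => deriv (fun s => u 0 s t) 0) q' (Set.Ico 0 T) 0 ∧
      p' + q' = r := by
  set S := cylinder Ω T
  set V : ℝ × ℝ × ℝ → ℝ := fun p => u p.1 p.2.1 p.2.2
  have m0 : (0 : ℝ) ∈ Set.Ico 0 T := ⟨le_rfl, hT⟩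
  have mS : ((0 : ℝ), (0 : ℝ), (0 : ℝ)) ∈ S := ⟨h0, m0⟩
  have hun : UniqueDiffOn ℝ S := uniqueDiffOn_cylinder hΩ
  set F := fderivWithin ℝ V S with hF
  have hVd {z : ℝ × ℝ × ℝ} (hz : z ∈ S) : HasFDerivWithinAt V (F z) S z :=
    (hu.differentiableOn (by norm_num) z hz).hasFDerivWithinAt
  have hFd : HasFDerivWithinAt F (fderivWithin ℝ F S (0, 0, 0)) S (0, 0, 0) :=
    ((hu.fderivWithin hun (m := 1) (by norm_num)).differentiableOn (by norm_num) _
      mS).hasFDerivWithinAt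
  have hsymm : IsSymmSndFDerivWithinAt ℝ V S (0, 0, 0) :=
    (hu _ mS).isSymmSndFDerivWithinAt (by simp) hun
      (mem_closure_interior_cylinder hΩ hT h0) mS
  set D := fderivWithin ℝ F S (0, 0, 0) with hD
  have ev_mem {f : ℝ → ℝ × ℝ} {s₀ : ℝ} (hf : ContinuousAt f s₀) (h : f s₀ ∈ Ω) {t : ℝ}
      (ht : t ∈ Set.Ico 0 T) : ∀ᶠ s in 𝓝 s₀, ((f s).1, (f s).2, t) ∈ S := by
    filter_upwards [hf (hΩ.mem_nhds h)] with s hs using ⟨hs, ht⟩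
  have along {γ : ℝ → ℝ × ℝ × ℝ} {γ' : ℝ × ℝ × ℝ} {s₀ : ℝ} (hγ : HasDerivAt γ γ' s₀)
      (hev : ∀ᶠ s in 𝓝 s₀, γ s ∈ S) : HasDerivAt (fun s => V (γ s)) (F (γ s₀) γ') s₀ :=
    (hVd hev.self_of_nhds).comp_hasDerivAt s₀ hγ hev
  have alongWithin {γ : ℝ → ℝ × ℝ × ℝ} {γ' : ℝ × ℝ × ℝ}
      (hγ : HasDerivWithinAt γ γ' (Set.Ico 0 T) 0) (hm : Set.MapsTo γ (Set.Ico 0 T) S) :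
      HasDerivWithinAt (fun t => V (γ t)) (F (γ 0) γ') (Set.Ico 0 T) 0 :=
    (hVd (hm m0)).comp_hasDerivWithinAt (0 : ℝ) hγ hm
  have slice_x {t : ℝ} (ht : t ∈ Set.Ico 0 T) :
      deriv (fun s => u s 0 t) 0 = F (0, 0, t) (1, 0, 0) :=
    (along (γ := fun s => (s, 0, t))
      ((hasDerivAt_id (0 : ℝ)).prodMk (hasDerivAt_const (0 : ℝ) ((0 : ℝ), t)))
      (ev_mem (f := fun s => (s, 0)) (by fun_prop) h0 ht)).deriv
  have slice_y {t : ℝ} (ht : t ∈ Set.Ico 0 T) :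
      deriv (fun s => u 0 s t) 0 = F (0, 0, t) (0, 1, 0) :=
    (along (γ := fun s => (0, s, t))
      ((hasDerivAt_const (0 : ℝ) (0 : ℝ)).prodMk
        ((hasDerivAt_id (0 : ℝ)).prodMk (hasDerivAt_const (0 : ℝ) t)))
      (ev_mem (f := fun s => (0, s)) (by fun_prop) h0 ht)).deriv
  have maps {x y : ℝ} (h : (x, y) ∈ Ω) :
      Set.MapsTo (fun t : ℝ => (x, y, t)) (Set.Ico 0 T) S := fun t ht => ⟨h, ht⟩
  have htime (x y : ℝ) : HasDerivWithinAt (fun t : ℝ => (x, y, t)) ((0 : ℝ), (0 : ℝ), (1 : ℝ))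
      (Set.Ico 0 T) 0 :=
    ((hasDerivAt_const (0 : ℝ) x).prodMk
      ((hasDerivAt_const (0 : ℝ) y).prodMk (hasDerivAt_id (0 : ℝ)))).hasDerivWithinAt
  have slice_t {x y : ℝ} (h : (x, y) ∈ Ω) :
      HasDerivWithinAt (fun t => u x y t) (F (x, y, 0) (0, 0, 1)) (Set.Ico 0 T) 0 :=
    alongWithin (γ := fun t => (x, y, t)) (htime x y) (maps h)
  have hFt : HasDerivWithinAt (fun t => F (0, 0, t)) (D (0, 0, 1)) (Set.Ico 0 T) 0 :=
    hFd.comp_hasDerivWithinAt (0 : ℝ) (htime 0 0) (maps h0)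
  have happ (v : ℝ × ℝ × ℝ) :
      HasDerivWithinAt (fun t => F (0, 0, t) v) (D (0, 0, 1) v) (Set.Ico 0 T) 0 := by
    simpa using hFt.clm_apply (hasDerivWithinAt_const (0 : ℝ) (Set.Ico 0 T) v)
  have hdiag : HasDerivAt (fun s => F (s, s, 0)) (D (1, 1, 0)) 0 :=
    hFd.comp_hasDerivAt (0 : ℝ) ((hasDerivAt_id (0 : ℝ)).prodMk
      ((hasDerivAt_id (0 : ℝ)).prodMk (hasDerivAt_const (0 : ℝ) (0 : ℝ))))
      (ev_mem (f := fun s => (s, s)) (by fun_prop) h0 m0)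
  have hdiag' : HasDerivAt (fun s => F (s, s, 0) (0, 0, 1)) (D (1, 1, 0) (0, 0, 1)) 0 := by
    simpa using hdiag.clm_apply (hasDerivAt_const (0 : ℝ) ((0 : ℝ), (0 : ℝ), (1 : ℝ)))
  have hRF : R =ᶠ[𝓝 0] fun s => F (s, s, 0) (0, 0, 1) := by
    have hd : ContinuousAt (fun s : ℝ => (s, s)) 0 := by fun_prop
    filter_upwards [hR, hd (hΩ.mem_nhds h0)] with s hs hsΩ
    exact (uniqueDiffOn_Ico (0 : ℝ) T 0 m0).eq_deriv _ hs (slice_t hsΩ)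
  refine ⟨D (0, 0, 1) (1, 0, 0), D (0, 0, 1) (0, 1, 0),
    (happ _).congr (fun t ht => slice_x ht) (slice_x m0),
    (happ _).congr (fun t ht => slice_y ht) (slice_y m0), ?_⟩
  rw [hr.unique (hdiag'.congr_of_eventuallyEq hRF), ← map_add, hsymm.eq]
  simp [← hF, ← hD]

lemma exists_forall_lt_of_hasDerivWithinAt_pos {f : ℝ → ℝ} {f' : ℝ} (hT : 0 < T)
    (hf : HasDerivWithinAt f f' (Set.Ico 0 T) 0) (hpos : 0 < f') :
    ∃ t₀ : ℝ, 0 < t₀ ∧ t₀ < T ∧ ∀ t, 0 < t → t < t₀ → f 0 < f t := by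
  have h := hf.mono Set.Ioo_subset_Ico_self
  rw [hasDerivWithinAt_iff_tendsto_slope' (by simp), nhdsWithin_Ioo_eq_nhdsGT hT] at h
  obtain ⟨b, hb, hsub⟩ := mem_nhdsGT_iff_exists_Ioo_subset.1 (h.eventually_const_lt hpos)
  refine ⟨min b (T / 2), lt_min hb (by linarith), (min_le_right _ _).trans_lt (by linarith),
    fun t ht htb => ?_⟩
  have hs : 0 < slope f 0 t := hsub ⟨ht, htb.trans_le (min_le_left _ _)⟩
  exact (slope_pos_iff_of_le ht.le).1 hs

end Evolution

lemma deriv_pmFlux_add_eq_pmOperator {φ : ℝ → ℝ} (hφ : ContDiff ℝ (⊤ : ℕ∞) φ)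
    {Ω : Set (ℝ × ℝ)} {u : ℝ → ℝ → ℝ → ℝ} {U : ℝ × ℝ → ℝ} (hΩ : IsOpen Ω)
    (hU : ContDiffOn ℝ 3 U Ω) (hu : ∀ x y : ℝ, (x, y) ∈ Ω → u x y 0 = U (x, y))
    {x y : ℝ} (hxy : (x, y) ∈ Ω) (hpos : 0 < normGradSq U (x, y)) :
    deriv (fun s => pmFlux1 φ u s y 0) x + deriv (fun s => pmFlux2 φ u x s 0) y =
      pmOperator φ U (x, y) := by
  have diff {n : WithTop ℕ∞} (hn : n ≠ 0) {F : ℝ × ℝ → ℝ} (hF : ContDiffOn ℝ n F Ω)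
      {z : ℝ × ℝ} (hz : z ∈ Ω) : DifferentiableAt ℝ F z :=
    (hF.contDiffAt (hΩ.mem_nhds hz)).differentiableAt hn
  have evx {x y : ℝ} (h : (x, y) ∈ Ω) : ∀ᶠ s in 𝓝 x, (s, y) ∈ Ω :=
    (show ContinuousAt (fun s : ℝ => (s, y)) x by fun_prop) (hΩ.mem_nhds h)
  have evy {x y : ℝ} (h : (x, y) ∈ Ω) : ∀ᶠ s in 𝓝 y, (x, s) ∈ Ω :=
    (show ContinuousAt (fun s : ℝ => (x, s)) y by fun_prop) (hΩ.mem_nhds h)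
  have dx {x y : ℝ} (h : (x, y) ∈ Ω) : deriv (fun s => u s y 0) x = pdx U (x, y) := by
    have e : (fun s => u s y 0) =ᶠ[𝓝 x] fun s => U (s, y) := (evx h).mono fun s hs => hu _ _ hs
    rw [e.deriv_eq, (diff (by norm_num) hU h).hasDerivAt_fst.deriv]
  have dy {x y : ℝ} (h : (x, y) ∈ Ω) : deriv (fun s => u x s 0) y = pdy U (x, y) := by
    have e : (fun s => u x s 0) =ᶠ[𝓝 y] fun s => U (x, s) := (evy h).mono fun s hs => hu _ _ hs
    rw [e.deriv_eq, (diff (by norm_num) hU h).hasDerivAt_snd.deriv]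
  have hp : ContDiffOn ℝ 2 (pdx U) Ω := contDiffOn_pdx hU hΩ (by norm_num)
  have hq : ContDiffOn ℝ 2 (pdy U) Ω := contDiffOn_pdy hU hΩ (by norm_num)
  have dp := diff (by norm_num) hp hxy
  have dq := diff (by norm_num) hq hxy
  have dG := diff (by norm_num) (contDiffOn_normGradSq hΩ hU) hxy
  have hB := (differentiableAt_diffusivity hφ hpos).hasDerivAt
  have e1 : (fun s => pmFlux1 φ u s y 0) =ᶠ[𝓝 x]
      fun s => diffusivity φ (normGradSq U (s, y)) * pdx U (s, y) := by
    filter_upwards [evx hxy] with s hs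
    rw [pmFlux1, gradSqT, dx hs, dy hs, diffusivity, normGradSq]
    ring
  have e2 : (fun s => pmFlux2 φ u x s 0) =ᶠ[𝓝 y]
      fun s => diffusivity φ (normGradSq U (x, s)) * pdy U (x, s) := by
    filter_upwards [evy hxy] with s hs
    rw [pmFlux2, gradSqT, dx hs, dy hs, diffusivity, normGradSq]
    ring
  have hBx : HasDerivAt (fun s => diffusivity φ (normGradSq U (s, y)))
      (deriv (diffusivity φ) (normGradSq U (x, y)) * pdx (normGradSq U) (x, y)) x :=
    HasDerivAt.comp (h₂ := diffusivity φ) (h := fun s => normGradSq U (s, y)) x hB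
      dG.hasDerivAt_fst
  have hBy : HasDerivAt (fun s => diffusivity φ (normGradSq U (x, s)))
      (deriv (diffusivity φ) (normGradSq U (x, y)) * pdy (normGradSq U) (x, y)) y :=
    HasDerivAt.comp (h₂ := diffusivity φ) (h := fun s => normGradSq U (x, s)) y hB
      dG.hasDerivAt_snd
  rw [e1.deriv_eq, e2.deriv_eq, (hBx.fun_mul dp.hasDerivAt_fst).deriv,
    (hBy.fun_mul dq.hasDerivAt_snd).deriv, pmOperator]
  ring

/-- Theorem 1.4 / `thm:example`.
There are coefficients `k₁, k₂, h₁, h₂` such that for every `C³` initial datum `u₀`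
with the corresponding third-order Taylor expansion at the origin:
(1) near the origin the supercritical region `{|∇u₀| > 1}` is the supergraph of a
convex function, and (2) for every `C²` solution of the generalized Perona–Malik
equation starting from `u₀` the origin is supercritical for all small positive
times. In particular subcritical regions need not expand in the nonradial case. -/
theorem nonradial_counterexample
    (φ : ℝ → ℝ) (hφ : ContDiff ℝ (⊤ : ℕ∞) φ)
    (hφ1pos : 0 < deriv φ 1) (hφ2one : deriv (deriv φ) 1 = 0) :
    ∃ k₁ k₂ h₁ h₂ : ℝ,
      ∀ Ω : Set (ℝ × ℝ), IsOpen Ω → ((0 : ℝ), (0 : ℝ)) ∈ Ω →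
      ∀ u₀ : ℝ → ℝ → ℝ, ContDiffOn ℝ 3 (fun p : ℝ × ℝ => u₀ p.1 p.2) Ω →
      ((fun p : ℝ × ℝ => u₀ p.1 p.2 -
        (Real.sqrt 2 / 2 * p.1 + Real.sqrt 2 / 2 * p.2 + k₁ * p.1 ^ 2 + k₂ * p.2 ^ 2 +
          h₁ * p.1 ^ 3 + h₂ * p.2 ^ 3)) =o[nhds ((0 : ℝ), (0 : ℝ))]
        fun p : ℝ × ℝ => (p.1 ^ 2 + p.2 ^ 2) ^ ((3 : ℝ) / 2)) →
      -- (1) the supercritical region of `u₀` is locally the supergraph of a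
      -- convex function
      (∃ δ > (0 : ℝ), ∃ a > (0 : ℝ), ∃ g : ℝ → ℝ,
        Set.Ioo (-δ) δ ×ˢ Set.Ioo (-a) a ⊆ Ω ∧
        ConvexOn ℝ (Set.Ioo (-δ) δ) g ∧
        (∀ x ∈ Set.Ioo (-δ) δ, g x ∈ Set.Ioo (-a) a) ∧
        (∀ x y : ℝ, x ∈ Set.Ioo (-δ) δ → y ∈ Set.Ioo (-a) a →
          (1 < gradSq0 u₀ x y ↔ g x < y))) ∧
      -- (2) for every solution starting from `u₀` the origin becomes supercritical
      (∀ T : ℝ, 0 < T → ∀ u : ℝ → ℝ → ℝ → ℝ,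
        ContDiffOn ℝ 2 (fun p : ℝ × ℝ × ℝ => u p.1 p.2.1 p.2.2)
          {p : ℝ × ℝ × ℝ | (p.1, p.2.1) ∈ Ω ∧ p.2.2 ∈ Set.Ico 0 T} →
        (∀ x y t : ℝ, (x, y) ∈ Ω → t ∈ Set.Ico 0 T →
          (deriv (fun s => u s y t) x ≠ 0 ∨ deriv (fun s => u x s t) y ≠ 0) →
          HasDerivWithinAt (fun s => u x y s)
            (deriv (fun s => pmFlux1 φ u s y t) x +
              deriv (fun s => pmFlux2 φ u x s t) y)
            (Set.Ico 0 T) t) →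
        (∀ x y : ℝ, (x, y) ∈ Ω → u x y 0 = u₀ x y) →
        ∃ t₀ : ℝ, 0 < t₀ ∧ t₀ < T ∧
          ∀ t : ℝ, 0 < t → t < t₀ → 1 < gradSqT u 0 0 t) := by
  set a := deriv φ 1 with ha
  set c := Real.sqrt 2 / 2 with hc
  set β := deriv (deriv (diffusivity φ)) 1
  set M := (1 + |12 * c * a - 8 * c * β|) / (3 * a) with hM
  have hcpos : 0 < c := by positivity
  have hc2 : c ^ 2 = 1 / 2 := by
    rw [hc, div_pow, Real.sq_sqrt (by norm_num)]
    norm_num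
  have hMa : 3 * a * M = 1 + |12 * c * a - 8 * c * β| := by
    rw [hM]
    field_simp
  refine ⟨0, 1, -1, 1 + M, fun Ω hΩ h0 u₀ hu₀ ho => ?_⟩
  set U : ℝ × ℝ → ℝ := fun p => u₀ p.1 p.2 with hUdef
  obtain ⟨j₁, j₂, j₃, j₄⟩ := jet_values hΩ h0 hu₀ ho
  norm_num at j₂ j₃
  obtain ⟨⟨Gx, Gy⟩, Gxx, -⟩ := normGradSq_derivs hΩ h0 hu₀ j₁ j₂ j₃ j₄
  have G0 : normGradSq U (0, 0) = 1 := by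
    rw [normGradSq, j₁.1, j₁.2]
    linarith
  refine ⟨?_, fun T hT u hu hpde hinit => ?_⟩
  · obtain ⟨δ, hδ, b, hb, g, hsub, hconv, hmaps, hiff⟩ :=
      exists_convexOn_superlevel hΩ h0 (contDiffOn_normGradSq hΩ hu₀) G0 Gx
        (by rw [Gy]; positivity) (by rw [Gxx]; linarith)
    refine ⟨δ, hδ, b, hb, g, hsub, hconv, hmaps, fun x y hx hy => ?_⟩
    have hd : DifferentiableAt ℝ U (x, y) :=
      (hu₀.contDiffAt (hΩ.mem_nhds (hsub ⟨hx, hy⟩))).differentiableAt (by norm_num)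
    have e : gradSq0 u₀ x y = normGradSq U (x, y) := by
      rw [gradSq0, normGradSq, ← hd.hasDerivAt_fst.deriv, ← hd.hasDerivAt_snd.deriv]
    rw [e]
    exact hiff x y hx hy
  · have m0 : (0 : ℝ) ∈ Set.Ico 0 T := ⟨le_rfl, hT⟩
    have hslice {x y : ℝ} (h : (x, y) ∈ Ω) :
        deriv (fun s => u s y 0) x = pdx U (x, y) ∧ deriv (fun s => u x s 0) y = pdy U (x, y) := by
      have hd : DifferentiableAt ℝ U (x, y) :=
        (hu₀.contDiffAt (hΩ.mem_nhds h)).differentiableAt (by norm_num)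
      have ex : (fun s => u s y 0) =ᶠ[𝓝 x] fun s => U (s, y) := by
        filter_upwards [(show ContinuousAt (fun s : ℝ => (s, y)) x by fun_prop)
          (hΩ.mem_nhds h)] with s hs using hinit _ _ hs
      have ey : (fun s => u x s 0) =ᶠ[𝓝 y] fun s => U (x, s) := by
        filter_upwards [(show ContinuousAt (fun s : ℝ => (x, s)) y by fun_prop)
          (hΩ.mem_nhds h)] with s hs using hinit _ _ hs
      exact ⟨by rw [ex.deriv_eq, hd.hasDerivAt_fst.deriv],
        by rw [ey.deriv_eq, hd.hasDerivAt_snd.deriv]⟩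
    have hev : ∀ᶠ z in 𝓝 ((0 : ℝ), (0 : ℝ)), z ∈ Ω ∧ 0 < normGradSq U z :=
      (show ∀ᶠ z in 𝓝 ((0 : ℝ), (0 : ℝ)), z ∈ Ω from hΩ.mem_nhds h0).and
        (((contDiffOn_normGradSq hΩ hu₀).continuousOn.continuousAt
          (hΩ.mem_nhds h0)).tendsto.eventually_const_lt (by rw [G0]; exact one_pos))
    have hdiag : Tendsto (fun s : ℝ => (s, s)) (𝓝 0) (𝓝 ((0 : ℝ), (0 : ℝ))) :=
      (show Continuous fun s : ℝ => (s, s) by fun_prop).tendsto 0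
    have hR : ∀ᶠ s in 𝓝 0,
        HasDerivWithinAt (fun t => u s s t) (pmOperator φ U (s, s)) (Set.Ico 0 T) 0 := by
      filter_upwards [hdiag.eventually hev] with s hs
      rw [← deriv_pmFlux_add_eq_pmOperator hφ hΩ hu₀ hinit hs.1 hs.2]
      refine hpde s s 0 hs.1 m0 ?_
      rw [(hslice hs.1).1, (hslice hs.1).2]
      by_contra! hzero
      have := hs.2
      rw [normGradSq, hzero.1, hzero.2] at this
      norm_num at this
    have hr := hasDerivAt_pmOperator_diagonal hφ hΩ h0 hu₀ hc2 j₁ j₂ j₃ j₄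
    obtain ⟨p', q', hp', hq', hsum⟩ := hasDerivWithinAt_gradient hΩ h0 hT hu hR hr
    have hG := (hp'.pow 2).add (hq'.pow 2)
    have hpos : 0 < p' + q' := by
      rw [hsum, deriv_diffusivity_one hφ hφ2one, diffusivity_one]
      have habs := le_abs_self (12 * c * a - 8 * c * β)
      linarith
    obtain ⟨t₀, ht₀, htT, hlt⟩ := exists_forall_lt_of_hasDerivWithinAt_pos hT hG (by
      rw [(hslice h0).1, (hslice h0).2, j₁.1, j₁.2]
      have := mul_pos (mul_pos two_pos hcpos) hpos
      norm_num
      linarith)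
    refine ⟨t₀, ht₀, htT, fun t ht htt => ?_⟩
    have h1 : gradSqT u 0 0 0 = 1 := by
      rw [gradSqT, (hslice h0).1, (hslice h0).2]
      exact G0
    rw [← h1]
    exact hlt t ht htt
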